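/- For every s with 1 ≤ s ≤ 2 there exists a continuous selection F_s : [a,b] → ℝ of the set-valued map Φ₁(t) = [t²+1, t²+2] (i.e. F_s(t) ∈ Φ₁(t) for all t) such that the graph of F_s has Hausdorff dimension s. -/

import Mathlib

open Set

open Set Filter Topology MeasureTheory
open scoped NNReal ENNReal

noncomputable section

/-- The weight of the `k`-th digit. -/
def wt (l : ℝ) (k : ℕ) : ℝ := l ^ k / (k + 1)

def WW (l : ℝ) (ω : ℕ → Bool) : ℝ := ∑' k, (if ω k then wt l k else 0)

lemma wt_nonneg {l : ℝ} (h0 : 0 < l) (k : ℕ) : 0 ≤ wt l k := by unfold wt; positivity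

lemma wt_le {l : ℝ} (h0 : 0 < l) (m k : ℕ) (h : m ≤ k) : wt l k ≤ l ^ k / (m + 1) := by
  unfold wt; gcongr

lemma wt_le' {l : ℝ} (h0 : 0 < l) (k : ℕ) : wt l k ≤ l ^ k := by
  have := wt_le h0 0 k (Nat.zero_le _)
  simpa using this

lemma wt_summable {l : ℝ} (h0 : 0 < l) (h1 : l ≤ 1 / 2) : Summable (wt l) :=
  Summable.of_nonneg_of_le (wt_nonneg h0) (wt_le' h0)
    (summable_geometric_of_lt_one h0.le (by linarith))

lemma WW_summable {l : ℝ} (h0 : 0 < l) (h1 : l ≤ 1 / 2) (ω : ℕ → Bool) :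
    Summable (fun k => if ω k then wt l k else 0) := by
  refine Summable.of_nonneg_of_le (fun k => ?_) (fun k => ?_) (wt_summable h0 h1)
  · split_ifs
    exacts [wt_nonneg h0 k, le_rfl]
  · split_ifs
    exacts [le_rfl, wt_nonneg h0 k]

lemma WW_cont {l : ℝ} (h0 : 0 < l) (h1 : l ≤ 1 / 2) : Continuous (WW l) := by
  unfold WW
  refine continuous_tsum (u := wt l) (fun k => ?_) (wt_summable h0 h1) (fun k ω => ?_)
  · have : Continuous (fun b : Bool => if b then wt l k else 0) := continuous_of_discreteTopology
    exact this.comp (continuous_apply k)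
  · split_ifs
    · rw [Real.norm_of_nonneg (wt_nonneg h0 k)]
    · simpa using wt_nonneg h0 k

/-- tail bound -/
lemma tail_sum {l : ℝ} (h0 : 0 < l) (h1 : l ≤ 1 / 2) (m : ℕ) (ω ω' : ℕ → Bool)
    (h : ∀ k < m, ω k = ω' k) : |WW l ω - WW l ω'| ≤ 2 * l ^ m / (m + 1) := by
  have e : WW l ω - WW l ω' =
      ∑' k, ((if ω k then wt l k else 0) - (if ω' k then wt l k else 0)) :=
    ((WW_summable h0 h1 ω).tsum_sub (WW_summable h0 h1 ω')).symm
  have hs := (WW_summable h0 h1 ω).sub (WW_summable h0 h1 ω')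
  have e2 := hs.sum_add_tsum_nat_add m
  rw [e, ← e2, Finset.sum_eq_zero, zero_add, ← Real.norm_eq_abs]
  · have hg : HasSum (fun k : ℕ => l ^ k * (l ^ m / (m + 1))) ((1 - l)⁻¹ * (l ^ m / (m + 1))) :=
      (hasSum_geometric_of_lt_one h0.le (by linarith)).mul_right _
    refine (tsum_of_norm_bounded hg (fun k => ?_)).trans ?_
    · have h2 : wt l (k + m) ≤ l ^ k * (l ^ m / (m + 1)) := by
        refine (wt_le h0 m (k + m) (by omega)).trans (le_of_eq ?_)
        rw [pow_add]; ring
      have h3 := wt_nonneg h0 (k + m)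
      rw [Real.norm_eq_abs, abs_le]
      constructor <;> split_ifs <;> linarith
    · have h4 : (1 - l)⁻¹ ≤ 2 := by
        rw [inv_le_comm₀ (by linarith) (by norm_num)]; linarith
      rw [mul_div_assoc]
      gcongr
  · intro k hk
    rw [h k (Finset.mem_range.1 hk), sub_self]

lemma WW_split {l : ℝ} (h0 : 0 < l) (h1 : l ≤ 1 / 2) (m : ℕ) (ω : ℕ → Bool) :
    WW l ω = (if ω m then wt l m else 0) + WW l (Function.update ω m false) := by
  unfold WW
  rw [(WW_summable h0 h1 ω).tsum_eq_add_tsum_ite m]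
  congr 1
  refine tsum_congr fun k => ?_
  by_cases hk : k = m
  · subst hk; simp
  · simp [hk]

lemma gap_aux {l : ℝ} (h0 : 0 < l) (h1 : l ≤ 1 / 2) (m : ℕ) (ω ω' : ℕ → Bool)
    (h : ∀ k < m, ω k = ω' k) (ht : ω m = true) (hf : ω' m = false) :
    l ^ m / ((m + 1) * (m + 2)) ≤ |WW l ω - WW l ω'| := by
  have h2 := WW_split h0 h1 m ω
  have h3 := tail_sum h0 h1 (m + 1) (Function.update ω m false) ω' (fun k hk => by
    by_cases hkm : k = m
    · subst hkm; simp [hf]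
    · simp only [ne_eq, hkm, not_false_eq_true, Function.update_of_ne]; exact h k (by omega))
  rw [if_pos ht] at h2
  have h4 : 2 * l ^ (m + 1) / ((m + 1 : ℕ) + 1) ≤ l ^ m / (m + 2) := by
    push_cast
    rw [pow_succ, show ((m : ℝ) + 1 + 1) = m + 2 by ring]
    gcongr
    have : 0 < l ^ m := by positivity
    nlinarith
  have h5 : wt l m - l ^ m / (m + 2) = l ^ m / ((m + 1) * (m + 2)) := by
    unfold wt; field_simp; ring
  refine le_trans ?_ (le_abs_self _)
  have := (abs_le.1 h3).1
  linarith

lemma gap_aux2 {l : ℝ} (h0 : 0 < l) (h1 : l ≤ 1 / 2) (m : ℕ) (ω ω' : ℕ → Bool)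
    (h : ∀ k < m, ω k = ω' k) (hne : ω m ≠ ω' m) :
    l ^ m / ((m + 1) * (m + 2)) ≤ |WW l ω - WW l ω'| := by
  cases h2 : ω m <;> cases h3 : ω' m
  · simp_all
  · rw [abs_sub_comm]; exact gap_aux h0 h1 m ω' ω (fun k hk => (h k hk).symm) h3 h2
  · exact gap_aux h0 h1 m ω ω' h h2 h3
  · simp_all

/-- closeness determines digits -/
lemma gap {l : ℝ} (h0 : 0 < l) (h1 : l ≤ 1 / 2) (m : ℕ) (ω ω' : ℕ → Bool)
    (hlt : |WW l ω - WW l ω'| < l ^ m / ((m + 1) * (m + 2))) : ∀ k ≤ m, ω k = ω' k := by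
  intro k
  induction k using Nat.strong_induction_on with
  | _ k ih =>
    intro hk
    by_contra hne
    have h2 := gap_aux2 h0 h1 k ω ω' (fun j hj => ih j hj (by omega)) hne
    have h3 : l ^ m / ((m + 1) * (m + 2)) ≤ l ^ k / (((k : ℝ) + 1) * (k + 2)) := by
      have h4 : l ^ m ≤ l ^ k := pow_le_pow_of_le_one h0.le (by linarith) hk
      gcongr
    linarith

lemma WW_inj {l : ℝ} (h0 : 0 < l) (h1 : l ≤ 1 / 2) : Function.Injective (WW l) := by
  intro ω ω' h
  funext k
  refine gap h0 h1 k ω ω' ?_ k le_rfl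
  rw [h, sub_self, abs_zero]; positivity

lemma WW_zero (l : ℝ) : WW l (fun _ => false) = 0 := by simp [WW]

lemma WW_mem {l : ℝ} (h0 : 0 < l) (h1 : l ≤ 1 / 2) (ω) : WW l ω ∈ Icc (0:ℝ) 2 := by
  constructor
  · refine tsum_nonneg fun k => ?_
    split_ifs
    exacts [wt_nonneg h0 k, le_rfl]
  · have := tail_sum h0 h1 0 ω (fun _ => false) (by simp)
    rw [WW_zero, sub_zero] at this
    have := (le_abs_self _).trans this
    simpa using this

def Psi (l : ℝ) (ω : ℕ → Bool) : ℝ × ℝ := (WW l ω, WW (1 / 2) (fun j => ω (2 ^ j)))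

lemma Psi_cont {l : ℝ} (h0 : 0 < l) (h1 : l ≤ 1 / 2) : Continuous (Psi l) := by
  unfold Psi
  refine (WW_cont h0 h1).prodMk ((WW_cont (by norm_num) le_rfl).comp ?_)
  fun_prop

/-- the scale parameter -/
lemma exists_l (t : ℝ) (ht0 : 0 < t) (ht1 : t ≤ 1) :
    ∃ l : ℝ, 0 < l ∧ l ≤ 1 / 2 ∧ ∀ x : ℝ, l ^ (x * t) = (2:ℝ) ^ (-x) := by
  refine ⟨(2:ℝ) ^ (-1 / t), by positivity, ?_, ?_⟩
  · have : (1 / 2 : ℝ) = (2:ℝ) ^ (-1 : ℝ) := by rw [Real.rpow_neg_one]; norm_num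
    rw [this]
    apply Real.rpow_le_rpow_of_exponent_le (by norm_num)
    rw [div_le_iff₀ ht0]; linarith
  · intro x
    rw [← Real.rpow_mul (by norm_num)]
    congr 1; field_simp

lemma upper (t : ℝ) (ht0 : 0 < t) (ht1 : t ≤ 1) (l : ℝ) (h0 : 0 < l) (h1 : l ≤ 1 / 2)
    (hl : ∀ x : ℝ, l ^ (x * t) = (2:ℝ) ^ (-x)) :
    dimH (range (Psi l)) ≤ ENNReal.ofReal (1 + t) := by
  set S : ℕ → Finset ℕ := fun n =>
    Finset.range ⌈(n:ℝ) * t⌉₊ ∪ (Finset.range n).image (fun j => 2 ^ j) with hS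
  have hcard : ∀ n, ((S n).card : ℝ) ≤ n * t + 1 + n := by
    intro n
    have h2 : (S n).card ≤ ⌈(n:ℝ) * t⌉₊ + n := by
      refine (Finset.card_union_le _ _).trans ?_
      refine add_le_add (by simp) (Finset.card_image_le.trans (by simp))
    have h3 : (⌈(n:ℝ) * t⌉₊ : ℝ) < n * t + 1 := Nat.ceil_lt_add_one (by positivity)
    have h4 : ((S n).card : ℝ) ≤ (⌈(n:ℝ) * t⌉₊ : ℝ) + n := by exact_mod_cast h2
    linarith
  set r : ℕ → ℝ := fun n => 2 * (2:ℝ) ^ (-(n:ℝ)) with hr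
  have hr' : ∀ n, r n = 2 * (1 / 2 : ℝ) ^ n := by
    intro n
    simp only [hr]
    rw [Real.rpow_neg (by norm_num), Real.rpow_natCast, one_div, inv_pow]
  have hrt : Tendsto (fun n => ENNReal.ofReal (r n)) atTop (𝓝 0) := by
    have : Tendsto r atTop (𝓝 0) := by
      have h2 := (tendsto_pow_atTop_nhds_zero_of_lt_one (r := (1/2:ℝ)) (by norm_num)
        (by norm_num)).const_mul 2
      simp only [mul_zero] at h2
      exact h2.congr fun n => (hr' n).symm
    simpa using ENNReal.tendsto_ofReal this
  set T : ∀ n : ℕ, (S n → Bool) → Set (ℝ × ℝ) := fun n σ =>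
    Psi l '' {ω | ∀ i : S n, ω i = σ i} with hT
  have hdiam : ∀ n σ, Metric.ediam (T n σ) ≤ ENNReal.ofReal (r n) := by
    intro n σ
    refine Metric.ediam_le ?_
    rintro _ ⟨ω, hω, rfl⟩ _ ⟨ω', hω', rfl⟩
    have hag : ∀ i ∈ S n, ω i = ω' i := fun i hi => (hω ⟨i, hi⟩).trans (hω' ⟨i, hi⟩).symm
    rw [edist_dist]
    apply ENNReal.ofReal_le_ofReal
    rw [Prod.dist_eq, max_le_iff, Real.dist_eq, Real.dist_eq]
    constructor
    · refine (tail_sum h0 h1 ⌈(n:ℝ) * t⌉₊ ω ω' (fun k hk => hag k ?_)).trans ?_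
      · simp [hS, hk]
      · have h2 : l ^ ⌈(n:ℝ) * t⌉₊ ≤ (2:ℝ) ^ (-(n:ℝ)) := by
          rw [← hl, ← Real.rpow_natCast]
          exact Real.rpow_le_rpow_of_exponent_ge h0 (by linarith) (Nat.le_ceil _)
        have h3 : 0 < l ^ ⌈(n:ℝ) * t⌉₊ := by positivity
        rw [div_le_iff₀ (by positivity)]
        have h4 : (0:ℝ) ≤ ⌈(n:ℝ) * t⌉₊ := Nat.cast_nonneg _
        simp only [hr]
        nlinarith
    · refine (tail_sum (by norm_num) le_rfl n _ _ (fun k hk => hag (2 ^ k) ?_)).trans ?_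
      · simp only [hS, Finset.mem_union, Finset.mem_image]
        exact Or.inr ⟨k, by simpa using hk, rfl⟩
      · rw [hr']
        exact div_le_self (by positivity) (by linarith [(Nat.cast_nonneg n : (0:ℝ) ≤ n)])
  have hmain := Measure.hausdorffMeasure_le_liminf_sum (1 + t) (range (Psi l)) _ hrt T
    (Eventually.of_forall hdiam) (Eventually.of_forall fun n => by
      rintro _ ⟨ω, rfl⟩
      exact mem_iUnion.2 ⟨fun i => ω i, ω, fun i => rfl, rfl⟩)
  have hsum : ∀ n, ∑ σ, Metric.ediam (T n σ) ^ (1 + t) ≤ ENNReal.ofReal 8 := by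
    intro n
    have hrp : 0 < r n := by simp only [hr]; positivity
    calc ∑ σ, Metric.ediam (T n σ) ^ (1 + t)
        ≤ ∑ σ : (S n → Bool), ENNReal.ofReal (r n) ^ (1 + t) :=
          Finset.sum_le_sum fun σ _ => ENNReal.rpow_le_rpow (hdiam n σ) (by linarith)
      _ = ENNReal.ofReal ((2:ℝ) ^ (S n).card * r n ^ (1 + t)) := by
          rw [Finset.sum_const, nsmul_eq_mul, ENNReal.ofReal_rpow_of_pos hrp,
            ENNReal.ofReal_mul (by positivity)]
          congr 1
          simp [ENNReal.ofReal_pow]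
      _ ≤ ENNReal.ofReal 8 := by
          apply ENNReal.ofReal_le_ofReal
          have h2 : r n = (2:ℝ) ^ (1 - (n:ℝ)) := by
            simp only [hr]
            rw [sub_eq_add_neg, Real.rpow_add (by norm_num), Real.rpow_one]
          rw [h2, ← Real.rpow_mul (by norm_num), ← Real.rpow_natCast,
            ← Real.rpow_add (by norm_num), show (8:ℝ) = (2:ℝ) ^ (3:ℝ) by norm_num]
          apply Real.rpow_le_rpow_of_exponent_le (by norm_num)
          nlinarith [hcard n]
  have hfin : μH[1 + t] (range (Psi l)) ≤ ENNReal.ofReal 8 := by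
    refine hmain.trans ?_
    refine (liminf_le_liminf (Eventually.of_forall hsum)).trans ?_
    simp
  have := dimH_le_of_hausdorffMeasure_ne_top (d := (1 + t).toNNReal) (s := range (Psi l)) (by
    rw [Real.coe_toNNReal _ (by linarith)]
    exact ne_top_of_le_ne_top ENNReal.ofReal_ne_top hfin)
  exact this

/-- fair coin measure -/
def coin : Measure Bool := (PMF.uniformOfFintype Bool).toMeasure

instance : IsProbabilityMeasure coin := by unfold coin; infer_instance

lemma coin_singleton (b : Bool) : coin {b} = 2⁻¹ := by
  unfold coin
  rw [PMF.toMeasure_apply_singleton _ _ (measurableSet_singleton b)]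
  simp

def coins : Measure (ℕ → Bool) := Measure.infinitePi (fun _ => coin)

instance : IsProbabilityMeasure coins := by unfold coins; infer_instance

lemma coins_cyl (S : Finset ℕ) (ω : ℕ → Bool) :
    coins (Set.pi S (fun i => {ω i})) = 2⁻¹ ^ S.card := by
  unfold coins
  rw [Measure.infinitePi_pi _ (fun i _ => measurableSet_singleton _)]
  simp [coin_singleton]

def hgap (N : ℕ) : ℝ := (1 / 2) ^ N / ((N + 1) * (N + 2))

lemma hgap_pos (N : ℕ) : 0 < hgap N := by unfold hgap; positivity

lemma hgap_tendsto : Tendsto hgap atTop (𝓝 0) := by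
  refine squeeze_zero (fun N => (hgap_pos N).le) (fun N => ?_)
    (tendsto_pow_atTop_nhds_zero_of_lt_one (r := (1/2:ℝ)) (by norm_num) (by norm_num))
  unfold hgap
  apply div_le_self (by positivity)
  have : (0:ℝ) ≤ N := Nat.cast_nonneg N
  nlinarith

lemma card_bound (M N : ℕ) (hMN : M ≤ N) :
    2 ^ (M + N + 1) ≤ 2 ^ (Finset.range (M + 1) ∪
      (Finset.range (N + 1)).image (fun j => 2 ^ j)).card * (N + 1) := by
  set R := Finset.range (M + 1)
  set I := (Finset.range (N + 1)).image (fun j => 2 ^ j)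
  have hI : I.card = N + 1 := by
    rw [Finset.card_image_of_injective _ (Nat.pow_right_injective le_rfl)]; simp
  have hRI : (R ∩ I).card ≤ Nat.log 2 M + 1 := by
    have : R ∩ I ⊆ (Finset.range (Nat.log 2 M + 1)).image (fun j => 2 ^ j) := by
      intro x hx
      simp only [R, I, Finset.mem_inter, Finset.mem_range, Finset.mem_image] at hx ⊢
      obtain ⟨hx1, j, hj, rfl⟩ := hx
      exact ⟨j, Nat.lt_succ_of_le (Nat.le_log_of_pow_le (by norm_num) (by omega)), rfl⟩
    refine (Finset.card_le_card this).trans (Finset.card_image_le.trans (by simp))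
  have h1 := Finset.card_union_add_card_inter R I
  have hR : R.card = M + 1 := by simp [R]
  have h2 : M + N + 1 ≤ (R ∪ I).card + Nat.log 2 M := by omega
  have h3 : 2 ^ Nat.log 2 M ≤ N + 1 := by
    rcases Nat.eq_zero_or_pos M with h | h
    · subst h; simp
    · exact (Nat.pow_log_le_self 2 h.ne').trans (by omega)
  calc 2 ^ (M + N + 1) ≤ 2 ^ ((R ∪ I).card + Nat.log 2 M) := Nat.pow_le_pow_right (by norm_num) h2
    _ = 2 ^ (R ∪ I).card * 2 ^ Nat.log 2 M := by rw [pow_add]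
    _ ≤ _ := by gcongr

def bd (t : ℝ) (N : ℕ) : ℝ := (N + 1) * (2:ℝ) ^ (-((N:ℝ) * (1 + t)))

lemma mass (t : ℝ) (ht0 : 0 < t) (ht1 : t ≤ 1) (l : ℝ) (h0 : 0 < l) (h1 : l ≤ 1 / 2)
    (hl : ∀ x : ℝ, l ^ (x * t) = (2:ℝ) ^ (-x)) (N : ℕ) (U : Set (ℝ × ℝ))
    (hU : Metric.ediam U < ENNReal.ofReal (hgap N)) :
    coins.map (Psi l) U ≤ ENNReal.ofReal (bd t N) := by
  refine (measure_mono subset_closure).trans ?_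
  rw [← Metric.ediam_closure] at hU
  rw [Measure.map_apply (Psi_cont h0 h1).measurable isClosed_closure.measurableSet]
  rcases (Psi l ⁻¹' closure U).eq_empty_or_nonempty with he | ⟨ω₀, hω₀⟩
  · rw [he]; simp
  set M := ⌊(N:ℝ) * t⌋₊ with hM
  have hN0 : (0:ℝ) ≤ N := Nat.cast_nonneg N
  have hMle : (M:ℝ) ≤ N * t := Nat.floor_le (by positivity)
  have hMN : M ≤ N := by
    have : (M:ℝ) ≤ N := by nlinarith
    exact_mod_cast this
  set S := Finset.range (M + 1) ∪ (Finset.range (N + 1)).image (fun j => 2 ^ j) with hS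
  have hsub : Psi l ⁻¹' closure U ⊆ Set.pi S (fun i => {ω₀ i}) := by
    intro ω hω
    have hd : dist (Psi l ω) (Psi l ω₀) < hgap N := by
      have := (Metric.edist_le_ediam_of_mem (s := closure U) (x := Psi l ω) (y := Psi l ω₀) hω hω₀).trans_lt hU
      rw [edist_dist] at this
      exact (ENNReal.ofReal_lt_ofReal_iff (hgap_pos N)).1 this
    rw [Prod.dist_eq, max_lt_iff, Real.dist_eq, Real.dist_eq] at hd
    have hx := gap h0 h1 M ω ω₀ (hd.1.trans_le (by
      have h2 : (1 / 2 : ℝ) ^ N ≤ l ^ M := by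
        have h3 : (1 / 2 : ℝ) ^ N = (2:ℝ) ^ (-(N:ℝ)) := by
          rw [Real.rpow_neg (by norm_num), Real.rpow_natCast, one_div, inv_pow]
        rw [h3, ← hl, ← Real.rpow_natCast]
        exact Real.rpow_le_rpow_of_exponent_ge h0 (by linarith) hMle
      have h4 : (M:ℝ) ≤ N := by exact_mod_cast hMN
      unfold hgap
      gcongr))
    have hy := gap (by norm_num) le_rfl N _ _ hd.2
    intro i hi
    rw [Finset.mem_coe, hS, Finset.mem_union, Finset.mem_image] at hi
    rcases hi with hi | ⟨j, hj, rfl⟩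
    · exact hx i (by have := Finset.mem_range.1 hi; omega)
    · exact hy j (by have := Finset.mem_range.1 hj; omega)
  refine (measure_mono hsub).trans ?_
  rw [coins_cyl]
  have e : (2⁻¹ : ℝ≥0∞) ^ S.card = ENNReal.ofReal ((2:ℝ)⁻¹ ^ S.card) := by
    rw [ENNReal.ofReal_pow (by norm_num), ENNReal.ofReal_inv_of_pos (by norm_num)]; simp
  rw [e]
  apply ENNReal.ofReal_le_ofReal
  have hc : (2:ℝ) ^ (M + N + 1) ≤ 2 ^ S.card * (N + 1) := by exact_mod_cast card_bound M N hMN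
  have h5 : (2:ℝ) ^ ((N:ℝ) * (1 + t)) ≤ 2 ^ (M + N + 1) := by
    rw [← Real.rpow_natCast]
    apply Real.rpow_le_rpow_of_exponent_le (by norm_num)
    have := Nat.lt_floor_add_one ((N:ℝ) * t)
    push_cast
    linarith
  unfold bd
  rw [Real.rpow_neg (by norm_num), inv_pow, ← div_eq_mul_inv, le_div_iff₀ (by positivity),
    inv_mul_le_iff₀ (by positivity)]
  exact h5.trans hc

lemma bd_eventually (t : ℝ) (ht1 : t ≤ 1) (d : ℝ) (hd0 : 0 ≤ d) (hd : d < 1 + t) :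
    ∀ᶠ N : ℕ in atTop, bd t N ≤ hgap (N + 1) ^ d := by
  set ρ : ℝ := (2:ℝ) ^ (-(1 + t - d)) with hρ
  have hρ0 : 0 < ρ := by positivity
  have hρ1 : ρ < 1 := Real.rpow_lt_one_of_one_lt_of_neg (by norm_num) (by linarith)
  have hT := (tendsto_pow_const_mul_const_pow_of_lt_one 5 hρ0.le hρ1).comp (tendsto_add_atTop_nat 3)
  have hT2 := hT.const_mul (4 * (ρ ^ 3)⁻¹)
  rw [mul_zero] at hT2
  filter_upwards [hT2.eventually_le_const zero_lt_one] with N hN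
  have hN' : 4 * ((N:ℝ) + 3) ^ 5 * ρ ^ N ≤ 1 := by
    refine le_trans (le_of_eq ?_) hN
    simp only [Function.comp]
    push_cast
    rw [pow_add]
    field_simp
  have hNN : (0:ℝ) ≤ N := Nat.cast_nonneg N
  have e1 : hgap (N + 1) ^ d = (2:ℝ) ^ (-((N:ℝ) + 1) * d) / (((N:ℝ) + 2) * (N + 3)) ^ d := by
    unfold hgap
    push_cast
    rw [Real.div_rpow (by positivity) (by positivity), Real.rpow_mul (by norm_num),
      Real.rpow_neg (by norm_num), one_div, inv_pow]
    norm_cast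
  have e2 : (((N:ℝ) + 2) * (N + 3)) ^ d ≤ ((N:ℝ) + 3) ^ 4 := by
    calc (((N:ℝ) + 2) * (N + 3)) ^ d ≤ (((N:ℝ) + 2) * (N + 3)) ^ (2:ℝ) :=
          Real.rpow_le_rpow_of_exponent_le (by nlinarith) (by linarith)
      _ = (((N:ℝ) + 2) * (N + 3)) ^ 2 := by norm_cast
      _ ≤ (((N:ℝ) + 3) * (N + 3)) ^ 2 := by gcongr; norm_num
      _ = _ := by ring
  have e3 : (2:ℝ) ^ (-((N:ℝ) * (1 + t))) = ρ ^ N * (2:ℝ) ^ (-(N:ℝ) * d) := by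
    rw [hρ, ← Real.rpow_natCast, ← Real.rpow_mul (by norm_num), ← Real.rpow_add (by norm_num)]
    congr 1; ring
  have e4 : (2:ℝ) ^ (-(N:ℝ) * d) ≤ 4 * (2:ℝ) ^ (-((N:ℝ) + 1) * d) := by
    rw [show (4:ℝ) = (2:ℝ) ^ (2:ℝ) by norm_num, ← Real.rpow_add (by norm_num)]
    apply Real.rpow_le_rpow_of_exponent_le (by norm_num)
    nlinarith
  rw [e1, le_div_iff₀ (by positivity)]
  unfold bd
  rw [e3]
  have p : 0 < (2:ℝ) ^ (-((N:ℝ) + 1) * d) := by positivity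
  calc ((N:ℝ) + 1) * (ρ ^ N * (2:ℝ) ^ (-(N:ℝ) * d)) * (((N:ℝ) + 2) * (N + 3)) ^ d
      ≤ ((N:ℝ) + 3) * (ρ ^ N * (4 * (2:ℝ) ^ (-((N:ℝ) + 1) * d))) * ((N:ℝ) + 3) ^ 4 := by
        gcongr; norm_num
    _ = (4 * ((N:ℝ) + 3) ^ 5 * ρ ^ N) * (2:ℝ) ^ (-((N:ℝ) + 1) * d) := by ring
    _ ≤ 1 * (2:ℝ) ^ (-((N:ℝ) + 1) * d) := by gcongr
    _ = _ := one_mul _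

lemma lower (t : ℝ) (ht0 : 0 < t) (ht1 : t ≤ 1) (l : ℝ) (h0 : 0 < l) (h1 : l ≤ 1 / 2)
    (hl : ∀ x : ℝ, l ^ (x * t) = (2:ℝ) ^ (-x)) :
    ENNReal.ofReal (1 + t) ≤ dimH (range (Psi l)) := by
  refine le_of_forall_lt_imp_le_of_dense fun c hc => ?_
  lift c to ℝ≥0 using (hc.trans ENNReal.ofReal_lt_top).ne
  have hd : (c:ℝ) < 1 + t := by
    rw [← ENNReal.ofReal_coe_nnreal] at hc
    exact (ENNReal.ofReal_lt_ofReal_iff (by linarith)).1 hc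
  obtain ⟨N₀, hN₀⟩ := eventually_atTop.1 (bd_eventually t ht1 c c.2 hd)
  rcases eq_or_ne c 0 with rfl | hc0
  · simp
  have hcpos : 0 < (c:ℝ) := by positivity
  have hle : coins.map (Psi l) ≤ μH[(c:ℝ)] := by
    refine Measure.le_hausdorffMeasure _ _ (ENNReal.ofReal (hgap N₀ / 2))
      (by simpa using hgap_pos N₀) fun U hU => ?_
    have hUt : Metric.ediam U ≠ ⊤ := ne_top_of_le_ne_top ENNReal.ofReal_ne_top hU
    set r := (Metric.ediam U).toReal with hr
    have hrU : Metric.ediam U = ENNReal.ofReal r := (ENNReal.ofReal_toReal hUt).symm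
    have hr0 : 0 ≤ r := ENNReal.toReal_nonneg
    have hrN : r < hgap N₀ := by
      rw [hrU, ENNReal.ofReal_le_ofReal_iff (by linarith [hgap_pos N₀])] at hU
      linarith [hgap_pos N₀]
    have hbound : ∀ N, N₀ ≤ N → r < hgap N →
        coins.map (Psi l) U ≤ ENNReal.ofReal (hgap (N + 1) ^ (c:ℝ)) := fun N hN hlt =>
      (mass t ht0 ht1 l h0 h1 hl N U (by
        rw [hrU]; exact (ENNReal.ofReal_lt_ofReal_iff (hgap_pos N)).2 hlt)).trans
        (ENNReal.ofReal_le_ofReal (hN₀ N hN))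
    rw [hrU, ENNReal.ofReal_rpow_of_nonneg hr0 hcpos.le]
    rcases hr0.eq_or_lt with hz | hpos
    · have hT : Tendsto (fun N => ENNReal.ofReal (hgap (N + 1) ^ (c:ℝ))) atTop (𝓝 0) := by
        have h3 := ((hgap_tendsto.comp (tendsto_add_atTop_nat 1)).rpow_const
          (p := (c:ℝ)) (Or.inr hcpos.le))
        rw [Real.zero_rpow hcpos.ne'] at h3
        simpa using ENNReal.tendsto_ofReal h3
      refine le_trans (ge_of_tendsto hT ?_) zero_le
      filter_upwards [eventually_ge_atTop N₀] with N hN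
      exact hbound N hN (by rw [← hz]; exact hgap_pos N)
    · have hex : ∃ N, N₀ ≤ N ∧ hgap (N + 1) ≤ r := by
        have h3 := (hgap_tendsto.comp (tendsto_add_atTop_nat 1)).eventually_le_const hpos
        obtain ⟨N, hN⟩ := (h3.and (eventually_ge_atTop N₀)).exists
        exact ⟨N, hN.2, hN.1⟩
      classical
      have hs := Nat.find_spec hex
      set N := Nat.find hex with hNdef
      have hlt : r < hgap N := by
        rcases hs.1.eq_or_lt with h | h
        · rw [← h]; exact hrN
        · have hm := Nat.find_min hex (m := N - 1) (by omega)
          rw [not_and, Nat.sub_add_cancel (by omega)] at hm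
          exact not_le.1 (hm (by omega))
      refine (hbound N hs.1 hlt).trans (ENNReal.ofReal_le_ofReal ?_)
      exact Real.rpow_le_rpow (hgap_pos _).le hs.2 hcpos.le
  refine le_dimH_of_hausdorffMeasure_ne_zero ?_
  have hge : 1 ≤ μH[(c:ℝ)] (range (Psi l)) := by
    refine le_trans ?_ (hle _)
    have hcm : IsCompact (range (Psi l)) := isCompact_range (Psi_cont h0 h1)
    rw [Measure.map_apply (Psi_cont h0 h1).measurable hcm.isClosed.measurableSet]
    simp
  intro hz
  rw [hz] at hge
  simp at hge

/-- Extension that is locally Lipschitz off a closed set, by averaging. -/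
lemma smooth_ext (C : Set ℝ) (hC : IsClosed C) (hne : C.Nonempty) (g₀ : ℝ → ℝ)
    (hc : Continuous g₀) (hm : ∀ x, g₀ x ∈ Icc (0:ℝ) 2) :
    ∃ g : ℝ → ℝ, Continuous g ∧ (∀ x, g x ∈ Icc (0:ℝ) 2) ∧ (∀ x ∈ C, g x = g₀ x) ∧
      dimH ((fun x => (x, g x)) '' Cᶜ) ≤ 1 := by
  set d : ℝ → ℝ := fun x => Metric.infDist x C with hd
  have hdl : LipschitzWith 1 d := Metric.lipschitz_infDist_pt C
  have hdc : Continuous d := hdl.continuous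
  set g : ℝ → ℝ := fun x => ∫ s in (0:ℝ)..1, g₀ (x + s * d x) with hg
  have hint : ∀ x, IntervalIntegrable (fun s => g₀ (x + s * d x)) volume 0 1 := fun x =>
    (by fun_prop : Continuous (fun s => g₀ (x + s * d x))).intervalIntegrable _ _
  refine ⟨g, ?_, ?_, ?_, ?_⟩
  · refine intervalIntegral.continuous_parametric_intervalIntegral_of_continuous' ?_ 0 1
    simp only [Function.uncurry_def]
    fun_prop
  · intro x
    constructor
    · exact intervalIntegral.integral_nonneg (by norm_num) (fun s _ => (hm _).1)
    · have := intervalIntegral.integral_mono_on (a := (0:ℝ)) (b := 1) (by norm_num) (hint x)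
        (intervalIntegrable_const (c := (2:ℝ))) (fun s _ => (hm _).2)
      simpa using this
  · intro x hx
    have : d x = 0 := Metric.infDist_zero_of_mem hx
    simp [hg, this]
  · set G : ℝ → ℝ := fun z => ∫ s in (0:ℝ)..z, g₀ s with hG
    have hGd : ∀ z, HasDerivAt G (g₀ z) z := fun z =>
      intervalIntegral.integral_hasDerivAt_right (hc.intervalIntegrable _ _)
        (hc.stronglyMeasurableAtFilter _ _) hc.continuousAt
    have hG1 : ContDiff ℝ 1 G := by
      rw [contDiff_one_iff_deriv]
      refine ⟨fun z => (hGd z).differentiableAt, ?_⟩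
      have : deriv G = g₀ := funext fun z => (hGd z).deriv
      rwa [this]
    have key : ∀ x ∈ Cᶜ, g x = (G (x + d x) - G x) / d x := by
      intro x hx
      have hpos : 0 < d x := (hC.notMem_iff_infDist_pos hne).1 hx
      have h1 := intervalIntegral.integral_comp_mul_add (a := 0) (b := 1) g₀ hpos.ne' x
      have h2 : g x = ∫ s in (0:ℝ)..1, g₀ (d x * s + x) := by
        simp only [hg]; congr 1; ext s; ring_nf
      rw [h2, h1, hG]
      simp only [mul_zero, zero_add, mul_one, smul_eq_mul]
      rw [intervalIntegral.integral_interval_sub_left (hc.intervalIntegrable _ _)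
        (hc.intervalIntegrable _ _), add_comm x (d x)]
      field_simp
    have himg : (fun x => (x, g x)) '' Cᶜ =
        (fun p : ℝ × ℝ => (p.1, (G (p.1 + p.2) - G p.1) / p.2)) '' ((fun x => (x, d x)) '' Cᶜ) := by
      rw [image_image]
      refine image_congr fun x hx => ?_
      simp only [Prod.mk.injEq, true_and]
      exact key x hx
    rw [himg]
    have hcd : ContDiffOn ℝ 1 (fun p : ℝ × ℝ => (p.1, (G (p.1 + p.2) - G p.1) / p.2))
        {p | 0 < p.2} := by
      refine ContDiffOn.prodMk contDiff_fst.contDiffOn ?_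
      refine ContDiffOn.div (ContDiff.contDiffOn ?_) contDiff_snd.contDiffOn (fun p hp => ne_of_gt hp)
      exact (hG1.comp (contDiff_fst.add contDiff_snd)).sub (hG1.comp contDiff_fst)
    refine (hcd.dimH_image_le ?_ ?_).trans ?_
    · exact convex_halfSpace_gt (IsLinearMap.mk (fun _ _ => rfl) (fun _ _ => rfl)) 0
    · rintro _ ⟨x, hx, rfl⟩
      exact (hC.notMem_iff_infDist_pos hne).1 hx
    · refine ((LipschitzWith.id.prodMk hdl).dimH_image_le Cᶜ).trans ?_
      exact (dimH_mono (subset_univ _)).trans Real.dimH_univ.le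

/-- transport to the band -/
lemma transport (a b : ℝ) (hab : a < b) (g : ℝ → ℝ) (hc : Continuous g)
    (hm : ∀ x, g x ∈ Icc (0:ℝ) 2) :
    ∃ F : ℝ → ℝ, ContinuousOn F (Icc a b) ∧
      (∀ t ∈ Icc a b, F t ∈ Icc (t ^ 2 + 1) (t ^ 2 + 2)) ∧
      dimH {x : ℝ × ℝ | x.1 ∈ Icc a b ∧ x.2 = F x.1} = dimH ((fun x => (x, g x)) '' Icc 0 2) := by
  have hb : 0 < b - a := sub_pos.2 hab
  refine ⟨fun t => t ^ 2 + 1 + g ((t - a) * (2 / (b - a))) / 2, by fun_prop, ?_, ?_⟩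
  · intro t _
    have := hm ((t - a) * (2 / (b - a)))
    constructor <;> linarith [this.1, this.2]
  · set S := {x : ℝ × ℝ | x.1 ∈ Icc a b ∧
      x.2 = (fun t => t ^ 2 + 1 + g ((t - a) * (2 / (b - a))) / 2) x.1} with hS
    set T := (fun x => (x, g x)) '' Icc (0:ℝ) 2 with hT
    set P : ℝ × ℝ → ℝ × ℝ := fun p => ((p.1 - a) * (2 / (b - a)), (p.2 - p.1 ^ 2 - 1) * 2)
    set Q : ℝ × ℝ → ℝ × ℝ :=
      fun p => (a + p.1 * ((b - a) / 2), p.2 / 2 + 1 + (a + p.1 * ((b - a) / 2)) ^ 2)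
    have hP : ContDiff ℝ 1 P := by fun_prop
    have hQ : ContDiff ℝ 1 Q := by fun_prop
    have h1 : T ⊆ P '' S := by
      rintro _ ⟨x, hx, rfl⟩
      have e : (a + x * ((b - a) / 2) - a) * (2 / (b - a)) = x := by field_simp; ring
      refine ⟨Q (x, g x), ⟨⟨?_, ?_⟩, ?_⟩, ?_⟩
      · simp only [Q]; nlinarith [hx.1]
      · simp only [Q]; nlinarith [hx.2]
      · simp only [Q]; rw [e]; ring
      · simp only [P, Q]; rw [e]; ext <;> simp
    have h2 : S ⊆ Q '' T := by
      rintro ⟨t, z⟩ ⟨ht, hz⟩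
      simp only at ht hz
      refine ⟨_, ⟨(t - a) * (2 / (b - a)), ⟨?_, ?_⟩, rfl⟩, ?_⟩
      · have := ht.1; have : 0 ≤ t - a := by linarith
        positivity
      · rw [mul_div_assoc', div_le_iff₀ hb]; linarith [ht.2]
      · have e : a + (t - a) * (2 / (b - a)) * ((b - a) / 2) = t := by field_simp; ring
        simp only [Q]; rw [e, hz]; ext <;> simp; ring
    apply le_antisymm
    · exact (dimH_mono h2).trans (hQ.contDiffOn.dimH_image_le convex_univ (subset_univ _))
    · exact (dimH_mono h1).trans (hP.contDiffOn.dimH_image_le convex_univ (subset_univ _))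

lemma exists_g (s : ℝ) (hs1 : 1 < s) (hs2 : s ≤ 2) :
    ∃ g : ℝ → ℝ, Continuous g ∧ (∀ x, g x ∈ Icc (0:ℝ) 2) ∧
      dimH ((fun x => (x, g x)) '' Icc 0 2) = ENNReal.ofReal s := by
  obtain ⟨l, h0, h1, hl⟩ := exists_l (s - 1) (by linarith) (by linarith)
  have hdim : dimH (range (Psi l)) = ENNReal.ofReal s := by
    have h2 := upper (s - 1) (by linarith) (by linarith) l h0 h1 hl
    have h3 := lower (s - 1) (by linarith) (by linarith) l h0 h1 hl
    rw [add_sub_cancel] at h2 h3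
    exact le_antisymm h2 h3
  have hemb : IsClosedEmbedding (WW l) := (WW_cont h0 h1).isClosedEmbedding (WW_inj h0 h1)
  let y : C(ℕ → Bool, ℝ) := ⟨fun ω => (Psi l ω).2, continuous_snd.comp (Psi_cont h0 h1)⟩
  obtain ⟨g₀, hg₀m, hg₀⟩ := y.exists_extension_forall_mem_of_isClosedEmbedding (t := Icc (0:ℝ) 2)
    (fun ω => WW_mem (by norm_num) le_rfl _) ⟨0, by norm_num⟩ hemb
  obtain ⟨g, hgc, hgm, hgC, hgd⟩ := smooth_ext (range (WW l)) hemb.isClosed_range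
    (range_nonempty _) g₀ g₀.continuous hg₀m
  have hgP : ∀ ω, (WW l ω, g (WW l ω)) = Psi l ω := by
    intro ω
    rw [hgC _ (mem_range_self ω)]
    have := congrFun hg₀ ω
    ext
    · rfl
    · exact this
  refine ⟨g, hgc, hgm, le_antisymm ?_ ?_⟩
  · have hsub : (fun x => (x, g x)) '' Icc (0:ℝ) 2 ⊆
        range (Psi l) ∪ (fun x => (x, g x)) '' (range (WW l))ᶜ := by
      rintro _ ⟨x, -, rfl⟩
      by_cases hx : x ∈ range (WW l)
      · obtain ⟨ω, rfl⟩ := hx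
        exact Or.inl ⟨ω, (hgP ω).symm⟩
      · exact Or.inr ⟨x, hx, rfl⟩
    refine (dimH_mono hsub).trans ?_
    rw [dimH_union, hdim]
    refine max_le le_rfl (hgd.trans ?_)
    rw [← ENNReal.ofReal_one]
    exact ENNReal.ofReal_le_ofReal hs1.le
  · rw [← hdim]
    refine dimH_mono ?_
    rintro _ ⟨ω, rfl⟩
    exact ⟨WW l ω, WW_mem h0 h1 ω, hgP ω⟩

lemma exists_g' (s : ℝ) (hs1 : 1 ≤ s) (hs2 : s ≤ 2) :
    ∃ g : ℝ → ℝ, Continuous g ∧ (∀ x, g x ∈ Icc (0:ℝ) 2) ∧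
      dimH ((fun x => (x, g x)) '' Icc 0 2) = ENNReal.ofReal s := by
  rcases hs1.eq_or_lt with rfl | h
  · refine ⟨fun _ => 0, continuous_const, fun _ => by norm_num, ?_⟩
    have hiso : Isometry (fun x : ℝ => (x, (0:ℝ))) := by
      intro x y
      simp [Prod.edist_eq]
    rw [hiso.dimH_image, ENNReal.ofReal_one, Real.dimH_of_nonempty_interior]
    · simp
    · simp
  · exact exists_g s h hs2

end

theorem stmt_19 (a b : ℝ) (hab : a < b) (s : ℝ) (hs1 : 1 ≤ s) (hs2 : s ≤ 2) :
    ∃ F : ℝ → ℝ, ContinuousOn F (Icc a b) ∧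
      (∀ t ∈ Icc a b, F t ∈ Icc (t ^ 2 + 1) (t ^ 2 + 2)) ∧
      dimH {x : ℝ × ℝ | x.1 ∈ Icc a b ∧ x.2 = F x.1} = ENNReal.ofReal s := by
  obtain ⟨g, hgc, hgm, hgd⟩ := exists_g' s hs1 hs2
  obtain ⟨F, h1, h2, h3⟩ := transport a b hab g hgc hgm
  exact ⟨F, h1, h2, h3.trans hgd⟩
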